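/- Fix p22, r22 ∈ F with (p22, r22) ≠ (0, 0), and for a, b ∈ F set M(a,b) := T(q)((0,0; a,p22), (0,0; b,r22)). Call the elements of 𝔸 := {M(a,b) : a, b ∈ F} points, call a free cyclic submodule ℓ of ²T(q) a line if ℓ contains some element of 𝔸, and say a point M lies on a line ℓ when M ⊆ ℓ. Then this incidence structure is an affine plane of order q; explicitly: (i) the q² submodules M(a,b) (a, b ∈ F) are pairwise distinct; (ii) for any two distinct points there is exactly one line containing both of them; (iii) for every line ℓ and every point M with ¬(M ⊆ ℓ) there is exactly one line m such that M ⊆ m and no point is contained in both ℓ and m; (iv) there exist three points that are not all contained in one common line; (v) every line contains exactly q points. -/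

import Mathlib

open Matrix

/-- `Mat n F` is the type of `n × n` matrices over `F`. -/
abbrev Mat (n : ℕ) (F : Type) : Type := Matrix (Fin n) (Fin n) F

/-- A matrix is lower triangular (i.e. belongs to the ring `T_n(q)`)
if all entries above the diagonal vanish. -/
def LowerTri {n : ℕ} {F : Type} [Zero F] (X : Mat n F) : Prop :=
  ∀ i j : Fin n, i < j → X i j = 0

/-- The cyclic left submodule `T_n(q)(X,Y)` of `²T_n(q)` generated by the pair `(X,Y)`. -/
def cyc {n : ℕ} {F : Type} [Field F] (X Y : Mat n F) : Set (Mat n F × Mat n F) :=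
  {p | ∃ A : Mat n F, LowerTri A ∧ p = (A * X, A * Y)}

/-- The pair `(X,Y)` generates a *free* cyclic submodule:
`A • (X,Y) = (0,0)` with `A ∈ T_n(q)` forces `A = 0`. -/
def IsFreePair {n : ℕ} {F : Type} [Field F] (X Y : Mat n F) : Prop :=
  ∀ A : Mat n F, LowerTri A → A * X = 0 → A * Y = 0 → A = 0

/-- A pair `(X,Y)` is unimodular if for every index `i` one of the `i`-th
diagonal entries of `X`, `Y` is nonzero. -/
def Unimodular {n : ℕ} {F : Type} [Field F] (X Y : Mat n F) : Prop :=
  ∀ i : Fin n, X i i ≠ 0 ∨ Y i i ≠ 0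

/-- `M` is a free cyclic submodule of `²T_n(q)`. -/
def IsFreeCyc {n : ℕ} {F : Type} [Field F] (M : Set (Mat n F × Mat n F)) : Prop :=
  ∃ X Y : Mat n F, LowerTri X ∧ LowerTri Y ∧ IsFreePair X Y ∧ M = cyc X Y

/-- `M` is a free cyclic submodule of `²T_n(q)` generated by a non-unimodular pair. -/
def IsNonUnimodFreeCyc {n : ℕ} {F : Type} [Field F] (M : Set (Mat n F × Mat n F)) : Prop :=
  ∃ X Y : Mat n F, LowerTri X ∧ LowerTri Y ∧ ¬ Unimodular X Y ∧ IsFreePair X Y ∧ M = cyc X Y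

/-- The point `M(a,b) = T(q)((0,0; a,p22),(0,0; b,r22))` of the affine plane. -/
def Mpt {F : Type} [Field F] (p22 r22 a b : F) : Set (Mat 2 F × Mat 2 F) :=
  cyc !![0, 0; a, p22] !![0, 0; b, r22]

/-- A line: a free cyclic submodule of `²T(q)` containing some point `M(a,b)`. -/
def IsLine {F : Type} [Field F] (p22 r22 : F) (l : Set (Mat 2 F × Mat 2 F)) : Prop :=
  IsFreeCyc l ∧ ∃ a b : F, Mpt p22 r22 a b ⊆ l
/-- The cyclic submodule with direction `(d₁, d₂)` through the point with coordinates `(c₁, c₂)`. -/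
def lineThrough {F : Type} [Field F] (p r d₁ d₂ c₁ c₂ : F) : Set (Mat 2 F × Mat 2 F) :=
  cyc !![d₁, 0; c₁, p] !![d₂, 0; c₂, r]

section

variable {F : Type} [Field F]

theorem LowerTri.exists_eq {X : Mat 2 F} (hX : LowerTri X) :
    ∃ s t u : F, X = !![s, 0; t, u] := by
  refine ⟨X 0 0, X 1 0, X 1 1, ?_⟩
  ext i j
  fin_cases i <;> fin_cases j <;> simp [hX 0 1 (by decide)]

theorem lowerTri_of (s t u : F) : LowerTri !![s, 0; t, u] := by
  intro i j h
  fin_cases i <;> fin_cases j <;> simp at h ⊢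

theorem mem_cyc_iff {x₁ x₂ x₃ y₁ y₂ y₃ : F} {p : Mat 2 F × Mat 2 F} :
    p ∈ cyc !![x₁, 0; x₂, x₃] !![y₁, 0; y₂, y₃] ↔
      ∃ s t u : F, p = (!![s * x₁, 0; t * x₁ + u * x₂, u * x₃],
        !![s * y₁, 0; t * y₁ + u * y₂, u * y₃]) := by
  constructor
  · rintro ⟨A, hA, rfl⟩
    obtain ⟨s, t, u, rfl⟩ := hA.exists_eq
    exact ⟨s, t, u, by simp⟩
  · rintro ⟨s, t, u, rfl⟩
    exact ⟨_, lowerTri_of s t u, by simp⟩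

theorem self_mem_cyc {n : ℕ} (X Y : Mat n F) : (X, Y) ∈ cyc X Y := by
  refine ⟨1, fun i j h => Matrix.one_apply_ne h.ne, by simp⟩

theorem lowerTri_mul {A B : Mat 2 F} (hA : LowerTri A) (hB : LowerTri B) :
    LowerTri (A * B) := by
  obtain ⟨s, t, u, rfl⟩ := hA.exists_eq
  obtain ⟨s', t', u', rfl⟩ := hB.exists_eq
  simpa using lowerTri_of (s * s') (t * s' + u * t') (u * u')

theorem cyc_subset_iff {X Y X' Y' : Mat 2 F} : cyc X Y ⊆ cyc X' Y' ↔ (X, Y) ∈ cyc X' Y' := by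
  refine ⟨fun h => h (self_mem_cyc X Y), ?_⟩
  rintro ⟨B, hB, h⟩ _ ⟨A, hA, rfl⟩
  obtain ⟨rfl, rfl⟩ := Prod.mk.inj h
  exact ⟨A * B, lowerTri_mul hA hB, by simp only [Matrix.mul_assoc]⟩

theorem cyc_subset_cyc_iff {x₁ x₂ x₃ y₁ y₂ y₃ x₁' x₂' x₃' y₁' y₂' y₃' : F} :
    cyc !![x₁, 0; x₂, x₃] !![y₁, 0; y₂, y₃] ⊆ cyc !![x₁', 0; x₂', x₃'] !![y₁', 0; y₂', y₃'] ↔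
      ∃ s t u : F, (x₁ = s * x₁' ∧ y₁ = s * y₁') ∧
        (x₂ = t * x₁' + u * x₂' ∧ y₂ = t * y₁' + u * y₂') ∧ (x₃ = u * x₃' ∧ y₃ = u * y₃') := by
  rw [cyc_subset_iff, mem_cyc_iff]
  refine exists_congr fun s => exists_congr fun t => exists_congr fun u => ?_
  simp [Prod.ext_iff]
  tauto

theorem isFreePair_iff {x₁ x₂ x₃ y₁ y₂ y₃ : F} (h : x₃ ≠ 0 ∨ y₃ ≠ 0) :
    IsFreePair !![x₁, 0; x₂, x₃] !![y₁, 0; y₂, y₃] ↔ x₁ ≠ 0 ∨ y₁ ≠ 0 := by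
  constructor
  · intro hf
    by_contra! h0
    obtain ⟨rfl, rfl⟩ := h0
    have := hf !![1, 0; 0, 0] (lowerTri_of 1 0 0) (by simp [← Matrix.ext_iff, Fin.forall_fin_two])
      (by simp [← Matrix.ext_iff, Fin.forall_fin_two])
    simpa using congrFun (congrFun this 0) 0
  · intro h1 A hA hX hY
    obtain ⟨s, t, u, rfl⟩ := hA.exists_eq
    simp [← Matrix.ext_iff, Fin.forall_fin_two] at hX hY ⊢
    grind

theorem exists_smul_of_mul_eq_mul {d₁ d₂ e₁ e₂ : F} (hd : d₁ ≠ 0 ∨ d₂ ≠ 0)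
    (h : e₁ * d₂ = e₂ * d₁) : ∃ k : F, e₁ = k * d₁ ∧ e₂ = k * d₂ := by
  rcases hd with hd | hd
  · exact ⟨e₁ / d₁, by field_simp, by field_simp; exact h.symm⟩
  · exact ⟨e₂ / d₂, by field_simp; exact h, by field_simp⟩

theorem eq_one_of_eq_mul {p r u : F} (hw : p ≠ 0 ∨ r ≠ 0) (hp : p = u * p) (hr : r = u * r) :
    u = 1 := by
  grind

theorem Mpt_subset_lineThrough_iff_exists {p r d₁ d₂ c₁ c₂ a b : F} (hw : p ≠ 0 ∨ r ≠ 0) :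
    Mpt p r a b ⊆ lineThrough p r d₁ d₂ c₁ c₂ ↔ ∃ t : F, a = t * d₁ + c₁ ∧ b = t * d₂ + c₂ := by
  rw [Mpt, lineThrough, cyc_subset_cyc_iff]
  constructor
  · rintro ⟨-, t, u, -, ⟨ha, hb⟩, hp, hr⟩
    obtain rfl := eq_one_of_eq_mul hw hp hr
    exact ⟨t, by simpa using ha, by simpa using hb⟩
  · rintro ⟨t, ha, hb⟩
    exact ⟨0, t, 1, by simpa using ⟨ha, hb⟩⟩

theorem Mpt_subset_lineThrough_iff {p r d₁ d₂ c₁ c₂ a b : F} (hw : p ≠ 0 ∨ r ≠ 0)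
    (hd : d₁ ≠ 0 ∨ d₂ ≠ 0) :
    Mpt p r a b ⊆ lineThrough p r d₁ d₂ c₁ c₂ ↔ (a - c₁) * d₂ = (b - c₂) * d₁ := by
  rw [Mpt_subset_lineThrough_iff_exists hw]
  constructor
  · rintro ⟨t, rfl, rfl⟩
    ring
  · intro h
    obtain ⟨t, h₁, h₂⟩ := exists_smul_of_mul_eq_mul hd h
    exact ⟨t, sub_eq_iff_eq_add.1 h₁, sub_eq_iff_eq_add.1 h₂⟩

theorem lineThrough_subset {p r d₁ d₂ c₁ c₂ e₁ e₂ a b : F} (hd : d₁ ≠ 0 ∨ d₂ ≠ 0)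
    (he : e₁ * d₂ = e₂ * d₁) (hc : (a - c₁) * d₂ = (b - c₂) * d₁) :
    lineThrough p r e₁ e₂ a b ⊆ lineThrough p r d₁ d₂ c₁ c₂ := by
  obtain ⟨s, h₁, h₂⟩ := exists_smul_of_mul_eq_mul hd he
  obtain ⟨t, h₃, h₄⟩ := exists_smul_of_mul_eq_mul hd hc
  rw [lineThrough, lineThrough, cyc_subset_cyc_iff]
  exact ⟨s, t, 1, ⟨h₁, h₂⟩, by simpa using ⟨sub_eq_iff_eq_add.1 h₃, sub_eq_iff_eq_add.1 h₄⟩,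
    by simp⟩

theorem lineThrough_congr {p r d₁ d₂ c₁ c₂ e₁ e₂ a b : F} (hd : d₁ ≠ 0 ∨ d₂ ≠ 0)
    (hne : e₁ ≠ 0 ∨ e₂ ≠ 0) (he : e₁ * d₂ = e₂ * d₁) (hc : (a - c₁) * d₂ = (b - c₂) * d₁) :
    lineThrough p r e₁ e₂ a b = lineThrough p r d₁ d₂ c₁ c₂ := by
  refine (lineThrough_subset hd he hc).antisymm (lineThrough_subset hne (by grind) ?_)
  grind

theorem isLine_iff {p r : F} (hw : p ≠ 0 ∨ r ≠ 0) {l : Set (Mat 2 F × Mat 2 F)} :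
    IsLine p r l ↔
      ∃ d₁ d₂ c₁ c₂ : F, (d₁ ≠ 0 ∨ d₂ ≠ 0) ∧ l = lineThrough p r d₁ d₂ c₁ c₂ := by
  constructor
  · rintro ⟨⟨X, Y, hX, hY, hf, rfl⟩, a, b, hab⟩
    obtain ⟨x₁, x₂, x₃, rfl⟩ := hX.exists_eq
    obtain ⟨y₁, y₂, y₃, rfl⟩ := hY.exists_eq
    obtain ⟨-, t, u, -, -, rfl, rfl⟩ := cyc_subset_cyc_iff.1 hab
    have hu : u ≠ 0 := by
      rintro rfl
      simp at hw
    refine ⟨x₁, y₁, u * x₂, u * y₂, (isFreePair_iff ?_).1 hf, ?_⟩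
    · exact hw.imp right_ne_zero_of_mul right_ne_zero_of_mul
    · apply Set.Subset.antisymm <;> rw [lineThrough, cyc_subset_cyc_iff]
      · exact ⟨1, 0, u⁻¹, by simp [hu]⟩
      · exact ⟨1, 0, u, by simp⟩
  · rintro ⟨d₁, d₂, c₁, c₂, hd, rfl⟩
    exact ⟨⟨_, _, lowerTri_of _ _ _, lowerTri_of _ _ _, (isFreePair_iff hw).2 hd, rfl⟩, c₁, c₂,
      (Mpt_subset_lineThrough_iff hw hd).2 (by simp)⟩

theorem Mpt_inj {p r a b a' b' : F} (hw : p ≠ 0 ∨ r ≠ 0) :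
    Mpt p r a b = Mpt p r a' b' ↔ a = a' ∧ b = b' := by
  refine ⟨fun h => ?_, by rintro ⟨rfl, rfl⟩; rfl⟩
  obtain ⟨-, t, u, -, ⟨ha, hb⟩, hp, hr⟩ := cyc_subset_cyc_iff.1 h.subset
  obtain rfl := eq_one_of_eq_mul hw hp hr
  simpa using And.intro ha hb

theorem existsUnique_isLine_through {p r a b a' b' : F} (hw : p ≠ 0 ∨ r ≠ 0)
    (hne : Mpt p r a b ≠ Mpt p r a' b') :
    ∃! l : Set (Mat 2 F × Mat 2 F), IsLine p r l ∧ Mpt p r a b ⊆ l ∧ Mpt p r a' b' ⊆ l := by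
  have hd : a' - a ≠ 0 ∨ b' - b ≠ 0 := by
    rw [Ne, Mpt_inj hw] at hne
    grind
  refine ⟨lineThrough p r (a' - a) (b' - b) a b, ⟨(isLine_iff hw).2 ⟨_, _, _, _, hd, rfl⟩,
    (Mpt_subset_lineThrough_iff hw hd).2 (by simp),
    (Mpt_subset_lineThrough_iff hw hd).2 (by ring)⟩, ?_⟩
  rintro m ⟨hm, h₁, h₂⟩
  obtain ⟨e₁, e₂, c₁, c₂, he, rfl⟩ := (isLine_iff hw).1 hm
  rw [Mpt_subset_lineThrough_iff hw he] at h₁ h₂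
  exact (lineThrough_congr he hd (by linear_combination h₂ - h₁) h₁).symm

theorem existsUnique_parallel {p r a b : F} (hw : p ≠ 0 ∨ r ≠ 0) {l : Set (Mat 2 F × Mat 2 F)}
    (hl : IsLine p r l) (hab : ¬ Mpt p r a b ⊆ l) :
    ∃! m : Set (Mat 2 F × Mat 2 F), IsLine p r m ∧ Mpt p r a b ⊆ m ∧
      ∀ a' b' : F, ¬ (Mpt p r a' b' ⊆ l ∧ Mpt p r a' b' ⊆ m) := by
  obtain ⟨d₁, d₂, c₁, c₂, hd, rfl⟩ := (isLine_iff hw).1 hl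
  rw [Mpt_subset_lineThrough_iff hw hd] at hab
  refine ⟨lineThrough p r d₁ d₂ a b, ⟨(isLine_iff hw).2 ⟨_, _, _, _, hd, rfl⟩,
    (Mpt_subset_lineThrough_iff hw hd).2 (by simp), ?_⟩, ?_⟩
  · intro a' b'
    rw [Mpt_subset_lineThrough_iff hw hd, Mpt_subset_lineThrough_iff hw hd]
    rintro ⟨h₁, h₂⟩
    exact hab (by linear_combination h₁ - h₂)
  · rintro m ⟨hm, h₁, h₂⟩
    obtain ⟨e₁, e₂, f₁, f₂, he, rfl⟩ := (isLine_iff hw).1 hm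
    rw [Mpt_subset_lineThrough_iff hw he] at h₁
    refine (lineThrough_congr he hd ?_ h₁).symm
    by_contra hdet
    have hdet' : d₁ * e₂ - d₂ * e₁ ≠ 0 := sub_ne_zero.2 hdet
    -- the parameter on `l` of the intersection point given by Cramer's rule
    obtain ⟨t, ht⟩ : ∃ t, t * (d₁ * e₂ - d₂ * e₁) = (f₁ - c₁) * e₂ - (f₂ - c₂) * e₁ :=
      ⟨_, div_mul_cancel₀ _ hdet'⟩
    apply h₂ (t * d₁ + c₁) (t * d₂ + c₂)
    rw [Mpt_subset_lineThrough_iff hw hd, Mpt_subset_lineThrough_iff hw he]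
    exact ⟨by ring, by linear_combination ht⟩

theorem ncard_points_of_isLine {p r : F} (hw : p ≠ 0 ∨ r ≠ 0) {l : Set (Mat 2 F × Mat 2 F)}
    (hl : IsLine p r l) :
    Set.ncard {P : Set (Mat 2 F × Mat 2 F) | (∃ a b : F, P = Mpt p r a b) ∧ P ⊆ l} =
      Nat.card F := by
  obtain ⟨d₁, d₂, c₁, c₂, hd, rfl⟩ := (isLine_iff hw).1 hl
  have hrange : {P : Set (Mat 2 F × Mat 2 F) | (∃ a b : F, P = Mpt p r a b) ∧
      P ⊆ lineThrough p r d₁ d₂ c₁ c₂} =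
      Set.range fun t : F => Mpt p r (t * d₁ + c₁) (t * d₂ + c₂) := by
    ext P
    constructor
    · rintro ⟨⟨a, b, rfl⟩, h⟩
      obtain ⟨t, rfl, rfl⟩ := (Mpt_subset_lineThrough_iff_exists hw).1 h
      exact ⟨t, rfl⟩
    · rintro ⟨t, rfl⟩
      exact ⟨⟨_, _, rfl⟩, (Mpt_subset_lineThrough_iff_exists hw).2 ⟨t, rfl, rfl⟩⟩
  rw [hrange, ← Set.image_univ, Set.ncard_image_of_injective, Set.ncard_univ]
  intro s t h
  obtain ⟨h₁, h₂⟩ := (Mpt_inj hw).1 h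
  rcases hd with hd | hd
  · exact mul_right_cancel₀ hd (add_right_cancel h₁)
  · exact mul_right_cancel₀ hd (add_right_cancel h₂)

theorem not_exists_isLine_of_standard_triangle {p r : F} (hw : p ≠ 0 ∨ r ≠ 0) :
    ¬ ∃ l : Set (Mat 2 F × Mat 2 F), IsLine p r l ∧
      Mpt p r 0 0 ⊆ l ∧ Mpt p r 1 0 ⊆ l ∧ Mpt p r 0 1 ⊆ l := by
  rintro ⟨l, hl, h₁, h₂, h₃⟩
  obtain ⟨d₁, d₂, c₁, c₂, hd, rfl⟩ := (isLine_iff hw).1 hl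
  rw [Mpt_subset_lineThrough_iff hw hd] at h₁ h₂ h₃
  rcases hd with hd | hd
  · exact hd (by linear_combination h₁ - h₃)
  · exact hd (by linear_combination h₂ - h₁)

end

theorem stmt_11 (q : ℕ) (hq : 2 ≤ q)
    (F : Type) [Field F] [Fintype F] (hF : Fintype.card F = q)
    (p22 r22 : F) (hpr : (p22, r22) ≠ (0, 0)) :
    -- (i) the q² points are pairwise distinct
    (∀ a b a' b' : F, Mpt p22 r22 a b = Mpt p22 r22 a' b' → a = a' ∧ b = b') ∧
    -- (ii) two distinct points lie on a unique line
    (∀ a b a' b' : F, Mpt p22 r22 a b ≠ Mpt p22 r22 a' b' →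
      ∃! l : Set (Mat 2 F × Mat 2 F), IsLine p22 r22 l ∧
        Mpt p22 r22 a b ⊆ l ∧ Mpt p22 r22 a' b' ⊆ l) ∧
    -- (iii) the parallel axiom
    (∀ l : Set (Mat 2 F × Mat 2 F), IsLine p22 r22 l →
      ∀ a b : F, ¬ Mpt p22 r22 a b ⊆ l →
        ∃! m : Set (Mat 2 F × Mat 2 F), IsLine p22 r22 m ∧ Mpt p22 r22 a b ⊆ m ∧
          ∀ a' b' : F, ¬ (Mpt p22 r22 a' b' ⊆ l ∧ Mpt p22 r22 a' b' ⊆ m)) ∧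
    -- (iv) three non-collinear points exist
    (∃ a₁ b₁ a₂ b₂ a₃ b₃ : F, ¬ ∃ l : Set (Mat 2 F × Mat 2 F), IsLine p22 r22 l ∧
      Mpt p22 r22 a₁ b₁ ⊆ l ∧ Mpt p22 r22 a₂ b₂ ⊆ l ∧ Mpt p22 r22 a₃ b₃ ⊆ l) ∧
    -- (v) every line carries exactly q points
    (∀ l : Set (Mat 2 F × Mat 2 F), IsLine p22 r22 l →
      Set.ncard {P : Set (Mat 2 F × Mat 2 F) |
        (∃ a b : F, P = Mpt p22 r22 a b) ∧ P ⊆ l} = q) := by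
  have hw : p22 ≠ 0 ∨ r22 ≠ 0 := by
    by_contra! h
    exact hpr (Prod.ext h.1 h.2)
  refine ⟨fun a b a' b' h => (Mpt_inj hw).1 h,
    fun a b a' b' h => existsUnique_isLine_through hw h,
    fun l hl a b h => existsUnique_parallel hw hl h,
    ⟨0, 0, 1, 0, 0, 1, not_exists_isLine_of_standard_triangle hw⟩, fun l hl => ?_⟩
  rw [ncard_points_of_isLine hw hl, Nat.card_eq_fintype_card, hF]
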